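/- Let Φ = P:φ be a QBC, let H be an axiom set of Φ, and let C be a clause appearing in a QU-resolution proof of Φ from H. Then every model of P:φ is a model of P:C. Consequently, if the empty clause appears in a QU-resolution proof of Φ from an axiom set, then Φ is false. -/

import Mathlib

/-! Framework for quantified Boolean circuits (QBCs), QU-resolution,
relaxations, and the prover–delayer game, following Chen,
"Proof Complexity Modulo the Polynomial Hierarchy". -/

/-- Quantifiers. -/
inductive Quant where
  | all : Quant
  | ex : Quant
deriving DecidableEq

/-- A partial assignment of Boolean values to (numbered) propositional
variables.  Via the correspondence `C ↔ assign(C)`, partial assignments also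
represent clauses (the clause `clause(a)` is the unique clause with variable
set `dom a` falsified by `a`); we freely identify the two. -/
abbrev PA : Type := ℕ → Option Bool

/-- The everywhere-undefined partial assignment (= the empty clause). -/
def emptyPA : PA := fun _ => none

/-- `g` extends the partial assignment `f`. -/
def ExtendsPA (g f : PA) : Prop := ∀ v b, f v = some b → g v = some b

/-- A total assignment `g` extends a partial assignment `f`; when `f`
represents a clause, this says `g` falsifies that clause. -/
def TotalExtends (g : ℕ → Bool) (f : PA) : Prop := ∀ v b, f v = some b → g v = b

/-- A partial assignment `r` satisfies a clause `C` (i.e. makes some literal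
of `C` true). -/
def SatisfiedBy (r : PA) (C : PA) : Prop := ∃ v b, C v = some b ∧ r v = some (!b)

/-- A quantified Boolean circuit: a quantifier prefix (a list of
quantifier/variable pairs) together with a Boolean function on total
assignments, represented as a predicate. -/
structure QBC where
  pfx : List (Quant × ℕ)
  matrix : (ℕ → Bool) → Prop

/-- The variables of the prefix of a QBC. -/
def QBC.vars (Φ : QBC) : List ℕ := Φ.pfx.map Prod.snd

/-- Well-formedness of a QBC: the prefix has no repeated variables, and the
matrix depends only on the values of the prefix variables. -/
def QBC.WellFormed (Φ : QBC) : Prop :=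
  Φ.vars.Nodup ∧
  ∀ f g : ℕ → Bool, (∀ v ∈ Φ.vars, f v = g v) → (Φ.matrix f ↔ Φ.matrix g)

/-- Standard semantics of a quantifier prefix over a matrix, starting from a
base assignment. -/
def evalQ : List (Quant × ℕ) → ((ℕ → Bool) → Prop) → (ℕ → Bool) → Prop
  | [], φ, g => φ g
  | (Quant.ex, v) :: P, φ, g => ∃ b, evalQ P φ (Function.update g v b)
  | (Quant.all, v) :: P, φ, g => ∀ b, evalQ P φ (Function.update g v b)

/-- Truth of a QBC. -/
def QBC.IsTrue (Φ : QBC) : Prop := ∀ g, evalQ Φ.pfx Φ.matrix g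

/-- Falsity of a QBC. -/
def QBC.IsFalse (Φ : QBC) : Prop := ¬ Φ.IsTrue

/-- The existentially quantified variables of a prefix. -/
def existVars (P : List (Quant × ℕ)) : List ℕ :=
  (P.filter fun p => decide (p.1 = Quant.ex)).map Prod.snd

/-- The universally quantified variables of a prefix. -/
def univVars (P : List (Quant × ℕ)) : List ℕ :=
  (P.filter fun p => decide (p.1 = Quant.all)).map Prod.snd

/-- The relation `u ⪯ v` of a prefix: `vᵢ ⪯ vⱼ` iff `i ≤ j`, or `j < i` and
`Qⱼ = Qⱼ₊₁ = ⋯ = Qᵢ`. -/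
def preceq (P : List (Quant × ℕ)) (u v : ℕ) : Prop :=
  ∃ i j : ℕ, (P[i]?).map Prod.snd = some u ∧ (P[j]?).map Prod.snd = some v ∧
    (i ≤ j ∨ (j < i ∧ ∀ k, j ≤ k → k ≤ i → (P[k]?).map Prod.fst = (P[j]?).map Prod.fst))

/-- `u` strictly precedes `v` (`u ⪯ v` and not `v ⪯ u`). -/
def strictPrec (P : List (Quant × ℕ)) (u v : ℕ) : Prop :=
  preceq P u v ∧ ¬ preceq P v u

/-- dom(f) ⪯ y : every variable on which `f` is defined is `⪯ y`. -/
def domPrec (P : List (Quant × ℕ)) (f : PA) (y : ℕ) : Prop :=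
  ∀ u, f u ≠ none → preceq P u y

/-- An ∃-strategy: a family of response functions for the existential
variables, each depending only on the universal variables strictly
preceding it. -/
def IsExStrategy (Φ : QBC) (σ : ℕ → (ℕ → Bool) → Bool) : Prop :=
  ∀ x ∈ existVars Φ.pfx, ∀ τ τ' : ℕ → Bool,
    (∀ y ∈ univVars Φ.pfx, strictPrec Φ.pfx y x → τ y = τ' y) → σ x τ = σ x τ'

/-- The total assignment `⟨σ, τ⟩` induced by an ∃-strategy `σ` and an
assignment `τ` to the universal variables. -/
def playE (Φ : QBC) (σ : ℕ → (ℕ → Bool) → Bool) (τ : ℕ → Bool) : ℕ → Bool :=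
  fun v => if v ∈ existVars Φ.pfx then σ v τ else τ v

/-- `σ` is a winning ∃-strategy of the prefix of `Φ` for the matrix `M`. -/
def ModelOf (Φ : QBC) (M : (ℕ → Bool) → Prop) (σ : ℕ → (ℕ → Bool) → Bool) : Prop :=
  IsExStrategy Φ σ ∧ ∀ τ : ℕ → Bool, M (playE Φ σ τ)

/-- A model of `Φ` (a winning ∃-strategy). -/
def QBC.Model (Φ : QBC) (σ : ℕ → (ℕ → Bool) → Bool) : Prop :=
  ModelOf Φ Φ.matrix σ

/-- `σ` is a model of `P : C`, where `P` is the prefix of `Φ` and `C` is a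
clause (represented by its falsifying assignment). -/
def ModelOfClause (Φ : QBC) (σ : ℕ → (ℕ → Bool) → Bool) (C : PA) : Prop :=
  ModelOf Φ (fun g => ¬ TotalExtends g C) σ

/-- `C` is an axiom of `Φ`: a clause on the variables of `Φ` such that every
model of `Φ` is a model of `P : C`. -/
def IsAxiom (Φ : QBC) (C : PA) : Prop :=
  (∀ v, C v ≠ none → v ∈ Φ.vars) ∧ ∀ σ, Φ.Model σ → ModelOfClause Φ σ C

/-- An axiom set of `Φ`. -/
def IsAxiomSet (Φ : QBC) (H : Set PA) : Prop := ∀ C ∈ H, IsAxiom Φ C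

/-- A ∀-strategy: response functions for the universal variables, each
depending only on the existential variables strictly preceding it. -/
def IsUnivStrategy (Φ : QBC) (τ : ℕ → (ℕ → Bool) → Bool) : Prop :=
  ∀ y ∈ univVars Φ.pfx, ∀ σ σ' : ℕ → Bool,
    (∀ x ∈ existVars Φ.pfx, strictPrec Φ.pfx x y → σ x = σ' x) → τ y σ = τ y σ'

/-- The total assignment `⟨τ, σ⟩` induced by a ∀-strategy `τ` and an
assignment `σ` to the existential variables. -/
def playU (Φ : QBC) (τ : ℕ → (ℕ → Bool) → Bool) (σ : ℕ → Bool) : ℕ → Bool :=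
  fun v => if v ∈ univVars Φ.pfx then τ v σ else σ v

/-- A winning ∀-strategy: every play falsifies the matrix. -/
def WinningUnivStrategy (Φ : QBC) (τ : ℕ → (ℕ → Bool) → Bool) : Prop :=
  IsUnivStrategy Φ τ ∧ ∀ σ : ℕ → Bool, ¬ Φ.matrix (playU Φ τ σ)

/-- `C` is obtainable from `D` by ∀-elimination (relative to prefix `P`):
`C = D ∖ {L}` for a literal `L` on a universal variable `y` with
`vars(C) ⪯ y`.  In assignment form: `D` is `C` additionally defined on `y`. -/
def ForallElim (P : List (Quant × ℕ)) (C D : PA) : Prop :=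
  ∃ y b, y ∈ univVars P ∧ C y = none ∧ D = Function.update C y (some b) ∧
    ∀ u, C u ≠ none → preceq P u y

/-- `γ` is the resolvent of `α` and `β` on variable `v` (in falsifying
assignment form: `α` and `β` carry complementary literals on `v`, `γ` is
the union of the remainders, which must be a clause). -/
def IsResolvent (γ α β : PA) (v : ℕ) : Prop :=
  ∃ b, α v = some b ∧ β v = some (!b) ∧ γ v = none ∧
    (∀ u, u ≠ v → γ u = (α u).elim (β u) some) ∧
    (∀ u, u ≠ v → ∀ b₁ b₂, α u = some b₁ → β u = some b₂ → b₁ = b₂)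

/-- A step in a QU-resolution proof: an axiom, a ∀-elimination (annotated with
the index of its source), or a resolution step (annotated with the indices of
its two sources and the resolved variable). -/
inductive QUStep where
  | ax (C : PA)
  | elim (C : PA) (src : ℕ)
  | res (C : PA) (src₁ src₂ : ℕ) (v : ℕ)

/-- The clause of a proof step. -/
def QUStep.clause : QUStep → PA
  | .ax C => C
  | .elim C _ => C
  | .res C _ _ _ => C

/-- The clause at position `i` of a proof. -/
def stepClause? (L : List QUStep) (i : ℕ) : Option PA := (L[i]?).map QUStep.clause

/-- Validity of the `i`-th step of a proof from axiom set `H`. -/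
def validStep (P : List (Quant × ℕ)) (H : Set PA) (L : List QUStep) (i : ℕ) : Prop :=
  match L[i]? with
  | none => True
  | some (.ax C) => C ∈ H
  | some (.elim C j) => j < i ∧ ∃ D, stepClause? L j = some D ∧ ForallElim P C D
  | some (.res C j k v) => j < i ∧ k < i ∧
      ∃ α β, stepClause? L j = some α ∧ stepClause? L k = some β ∧ IsResolvent C α β v

/-- A QU-resolution proof of `Φ` from axiom set `H`. -/
def IsQUProof (Φ : QBC) (H : Set PA) (L : List QUStep) : Prop :=
  ∀ i, validStep Φ.pfx H L i

/-- A QU-resolution falsity proof: a proof ending with the empty clause. -/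
def IsFalsityProof (Φ : QBC) (H : Set PA) (L : List QUStep) : Prop :=
  IsQUProof Φ H L ∧ (L.getLast?).map QUStep.clause = some emptyPA

/-- The clause `C` appears in the proof `L`. -/
def AppearsIn (L : List QUStep) (C : PA) : Prop := ∃ i, stepClause? L i = some C

/-- The edge relation of the graph `G(π)`: an edge from each clause occurrence
to the clause occurrence(s) from which it is derived. -/
def edge (L : List QUStep) (i j : ℕ) : Prop :=
  match L[i]? with
  | some (.elim _ s) => j = s
  | some (.res _ s t _) => j = s ∨ j = t
  | _ => False

/-- A sink (leaf) of `G(π)`: a vertex with no outgoing edges. -/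
def isSink (L : List QUStep) (i : ℕ) : Prop := i < L.length ∧ ∀ j, ¬ edge L i j

/-- The proof is tree-like: `G(π)` is a tree (each vertex has at most one
incoming edge; acyclicity holds automatically since edges decrease indices). -/
def TreeLike (L : List QUStep) : Prop := ∀ j : ℕ, {i | edge L i j}.Subsingleton

-- The prefix `P[a]`: the variables of `dom a` are removed, and the
-- quantifier of every variable strictly preceding some variable of `dom a`
-- (equivalently, every `v` with `v ⪯ last(a)` and not `last(a) ⪯ v`) is
-- changed to `∃`.
open Classical in
noncomputable def instPrefix (P : List (Quant × ℕ)) (a : PA) : List (Quant × ℕ) :=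
  (P.filter fun p => (a p.2).isNone).map fun p =>
    (if ∃ u, a u ≠ none ∧ strictPrec P p.2 u then Quant.ex else p.1, p.2)

/-- Overriding a total assignment by a partial assignment. -/
def override (a : PA) (g : ℕ → Bool) : ℕ → Bool := fun v => (a v).getD (g v)

/-- The instantiated QBC `Φ[a]` = `P[a] : φ[a]`. -/
noncomputable def QBC.inst (Φ : QBC) (a : PA) : QBC :=
  ⟨instPrefix Φ.pfx a, fun g => Φ.matrix (override a g)⟩

/-- `P'` is a relaxation of the prefix `P`: a permutation of `P` such that
`y ⪯ x` implies `y ⪯' x` for every universal `y` and existential `x`. -/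
def IsRelaxationPfx (P P' : List (Quant × ℕ)) : Prop :=
  P.Perm P' ∧ ∀ y ∈ univVars P, ∀ x ∈ existVars P, preceq P y x → preceq P' y x

/-- `Φ'` is a relaxation of the QBC `Φ`. -/
def IsRelaxation (Φ Φ' : QBC) : Prop :=
  IsRelaxationPfx Φ.pfx Φ'.pfx ∧ Φ'.matrix = Φ.matrix

/-- Negation of a quantifier. -/
def Quant.neg : Quant → Quant
  | .all => .ex
  | .ex => .all

/-- `isAltFrom q i qs`: the quantifier string `qs` consists of (at most) `i`
alternating possibly-empty blocks, starting with a block of `q`s. -/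
def isAltFrom : Quant → ℕ → List Quant → Prop
  | _, 0, qs => qs = []
  | q, i + 1, qs => ∃ k rest, qs = List.replicate k q ++ rest ∧ isAltFrom q.neg i rest

/-- The prefix `P` is `Π_i`: its quantifier string lies in `∀*∃*∀*⋯` with `i`
alternating starred blocks beginning with `∀*`. -/
def isPiPrefix (i : ℕ) (P : List (Quant × ℕ)) : Prop :=
  isAltFrom Quant.all i (P.map Prod.fst)

/-- The axiom set `H(Φ, Π_k)`: the clauses `C` on variables of `Φ` such that
some `Π_k`-relaxation of `Φ[assign(C)]` is false. -/
def Hset (Φ : QBC) (k : ℕ) : Set PA :=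
  {C | (∀ v, C v ≠ none → v ∈ Φ.vars) ∧
    ∃ Φ' : QBC, IsRelaxation (Φ.inst C) Φ' ∧ isPiPrefix k Φ'.pfx ∧ Φ'.IsFalse}

/-- `g` is a semicompletion of `f` (relative to prefix `P`). -/
def SemiComp (P : List (Quant × ℕ)) (f g : PA) : Prop :=
  ExtendsPA g f ∧
  ∀ y ∈ univVars P, f y = none → domPrec P f y → (g y = none ∧ domPrec P g y)

/-- A set of partial assignments of `Φ` is semicompletion-closed. -/
def SemiCompClosed (Φ : QBC) (H : Set PA) : Prop :=
  ∀ f ∈ H, ∀ g : PA, (∀ v, g v ≠ none → v ∈ Φ.vars) → SemiComp Φ.pfx f g → g ∈ H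

/-- Delayer condition (semicompletion-of-empty). -/
def CondEmpty (Φ : QBC) (F : Set PA) (s : PA → ℕ) : Prop :=
  ∃ g ∈ F, SemiComp Φ.pfx emptyPA g ∧ s g = 0

/-- Delayer condition (monotonicity). -/
def CondMono (Φ : QBC) (F : Set PA) (s : PA → ℕ) : Prop :=
  ∀ g ∈ F, ∀ f' : PA, ExtendsPA g f' → ∃ f ∈ F, SemiComp Φ.pfx f' f ∧ s f ≤ s g

/-- Delayer condition (∀-branching). -/
def CondForallB (Φ : QBC) (F : Set PA) (s : PA → ℕ) : Prop :=
  ∀ f ∈ F, ∀ y ∈ univVars Φ.pfx, f y = none → domPrec Φ.pfx f y →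
    ∀ b : Bool, ∃ g ∈ F, SemiComp Φ.pfx (Function.update f y (some b)) g ∧ s g = s f

/-- Delayer condition (double-branching). -/
def CondDoubleB (Φ : QBC) (F : Set PA) (s : PA → ℕ) : Prop :=
  ∀ f ∈ F, ∀ v ∈ Φ.vars, f v = none →
    ∃ b : Bool, ∃ g ∈ F, SemiComp Φ.pfx (Function.update f v (some b)) g ∧
      s g ≤ s f + 1 ∧
      (s g = s f + 1 →
        ∃ g' ∈ F, SemiComp Φ.pfx (Function.update f v (some (!b))) g' ∧ s g' ≤ s f + 1)

/-- A `p`-point delayer strategy for `Φ` with respect to axiom set `H`. -/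
def IsDelayer (Φ : QBC) (H : Set PA) (p : ℕ) (F : Set PA) (s : PA → ℕ) : Prop :=
  (∀ f ∈ F, ∀ v, f v ≠ none → v ∈ Φ.vars) ∧
  CondEmpty Φ F s ∧ (∀ f ∈ F, f ∈ H → p ≤ s f) ∧
  CondMono Φ F s ∧ CondForallB Φ F s ∧ CondDoubleB Φ F s

/-! The separation formulas `Φₙ` of Section 6. -/

/-- The variable `x_{i,j,k}`. -/
def xV (i : ℕ) (j k : Bool) : ℕ := 9 * i + 2 * cond j 1 0 + cond k 1 0

/-- The variable `x'_{i,j,k}`. -/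
def xV' (i : ℕ) (j k : Bool) : ℕ := 9 * i + 4 + 2 * cond j 1 0 + cond k 1 0

/-- The variable `yᵢ`. -/
def yV (i : ℕ) : ℕ := 9 * i + 8

/-- A block of four quantified variables. -/
def blockOf (q : Quant) (f : Bool → Bool → ℕ) : List (Quant × ℕ) :=
  [(q, f false false), (q, f false true), (q, f true false), (q, f true true)]

/-- The prefix `∃X₀ ∃X'₁∀y₁∃X₁ ⋯ ∃X'ₙ∀yₙ∃Xₙ`. -/
def sepPrefix (n : ℕ) : List (Quant × ℕ) :=
  blockOf Quant.ex (xV 0) ++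
    (List.range n).flatMap fun i =>
      blockOf Quant.ex (xV' (i + 1)) ++ [(Quant.all, yV (i + 1))] ++
        blockOf Quant.ex (xV (i + 1))

/-- The clause `¬x_{0,j,k}` (as its falsifying assignment). -/
def clB1 (j k : Bool) : PA := fun v => if v = xV 0 j k then some true else none

/-- The clause `x_{n,j,0} ∨ x_{n,j,1}`. -/
def clB2 (n : ℕ) (j : Bool) : PA :=
  fun v => if v = xV n j false ∨ v = xV n j true then some false else none

/-- The clause `¬x'_{i,0,k} ∨ ¬x'_{i,1,l} ∨ x_{i−1,j,0} ∨ x_{i−1,j,1}`. -/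
def clH (i : ℕ) (j k l : Bool) : PA := fun v =>
  if v = xV' i false k ∨ v = xV' i true l then some true
  else if v = xV (i - 1) j false ∨ v = xV (i - 1) j true then some false
  else none

/-- For `j = false` the clause `¬x_{i,0,k} ∨ yᵢ ∨ x'_{i,0,k}`; for `j = true`
the clause `¬x_{i,1,k} ∨ ¬yᵢ ∨ x'_{i,1,k}`. -/
def clT (i : ℕ) (j k : Bool) : PA := fun v =>
  if v = xV i j k then some true
  else if v = yV i then some j
  else if v = xV' i j k then some false
  else none

/-- The set `Tᵢ` of clauses. -/
def Tset (i : ℕ) : Set PA := {C | ∃ j k : Bool, C = clT i j k}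

/-- The set of clauses of the matrix `φₙ`. -/
def sepClauses (n : ℕ) : Set PA :=
  {C | (∃ j k : Bool, C = clB1 j k) ∨ (∃ j : Bool, C = clB2 n j) ∨
    (∃ i, 1 ≤ i ∧ i ≤ n ∧ ∃ j k l : Bool, C = clH i j k l) ∨
    (∃ i, 1 ≤ i ∧ i ≤ n ∧ ∃ j k : Bool, C = clT i j k)}

/-- The separation formula `Φₙ`. -/
def sepQBC (n : ℕ) : QBC :=
  ⟨sepPrefix n, fun g => ∀ C ∈ sepClauses n, ¬ TotalExtends g C⟩

/-- The level-`i` variables `X'ᵢ ∪ {yᵢ} ∪ Xᵢ`. -/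
def levelVars (i : ℕ) : List ℕ :=
  [xV' i false false, xV' i false true, xV' i true false, xV' i true true, yV i,
   xV i false false, xV i false true, xV i true false, xV i true true]

/-- `r` is defined exactly on the level-`i` variables. -/
def OnLevel (i : ℕ) (r : PA) : Prop := ∀ v, r v ≠ none ↔ v ∈ levelVars i

/-- A normal realization of level `i`. -/
def NormalReal (i : ℕ) (r : PA) : Prop :=
  OnLevel i r ∧ ∃ b : Bool, r (yV i) = some b ∧
    r (xV i b false) = some false ∧ r (xV' i b false) = some false ∧
    r (xV i b true) = some false ∧ r (xV' i b true) = some false ∧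
    ∃ c : Bool, r (xV i (!b) false) = some c ∧ r (xV' i (!b) false) = some c ∧
      r (xV i (!b) true) = some (!c) ∧ r (xV' i (!b) true) = some (!c)

/-- A funny realization of level `i`. -/
def FunnyReal (i : ℕ) (r : PA) : Prop :=
  OnLevel i r ∧ ∃ b : Bool, r (yV i) = some b ∧
    (∃ c : Bool, r (xV i b false) = some c ∧ r (xV' i b false) = some c ∧
      r (xV i b true) = some (!c) ∧ r (xV' i b true) = some (!c)) ∧
    r (xV' i (!b) false) = some false ∧ r (xV' i (!b) true) = some false ∧
    ∃ d : Bool, r (xV i (!b) false) = some d ∧ r (xV i (!b) true) = some (!d)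

/-- Restriction of a partial assignment to the level-`i` variables. -/
def restrictLevel (i : ℕ) (f : PA) : PA :=
  fun v => if v ∈ levelVars i then f v else none

-- The maximum level `ℓ` containing an existentially quantified variable of
-- `dom f` (and `0` if there is none).
open Classical in
noncomputable def maxLevel (n : ℕ) (f : PA) : ℕ :=
  ((Finset.Icc 1 n).filter fun i => ∃ v ∈ levelVars i, v ≠ yV i ∧ f v ≠ none).sup id

/-- `f` is half-defined on level `ℓ`. -/
def HalfDefined (ℓ : ℕ) (f : PA) : Prop :=
  (∀ j k : Bool, f (xV ℓ j k) = none) ∧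
  (∃ j k : Bool, f (xV' ℓ j k) = some true ∧
    ∀ j' k' : Bool, (j', k') ≠ (j, k) → f (xV' ℓ j' k') = some false)

/-- A normal assignment of `Φₙ`. -/
def NormalAssign (n : ℕ) (f : PA) : Prop :=
  (∀ v, f v ≠ none → v ∈ (sepPrefix n).map Prod.snd) ∧
  (∀ j k : Bool, f (xV 0 j k) = some false) ∧
  (∀ i, 1 ≤ i → i + 1 ≤ maxLevel n f → NormalReal i (restrictLevel i f)) ∧
  (1 ≤ maxLevel n f →
    (NormalReal (maxLevel n f) (restrictLevel (maxLevel n f) f) ∨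
      HalfDefined (maxLevel n f) f))

/-- A funny assignment of `Φₙ`, with witness `m` (so that `sₙ(f) = m`). -/
def FunnyAssign (n : ℕ) (f : PA) (m : ℕ) : Prop :=
  (∀ v, f v ≠ none → v ∈ (sepPrefix n).map Prod.snd) ∧
  1 ≤ m ∧ m ≤ maxLevel n f ∧
  (∀ j k : Bool, f (xV 0 j k) = some false) ∧
  (∀ i, 1 ≤ i → i < m → NormalReal i (restrictLevel i f)) ∧
  FunnyReal m (restrictLevel m f) ∧
  (∀ i, m < i → i ≤ maxLevel n f → ∀ j : Bool,
    ((f (xV i j false) ≠ none ∨ f (xV i j true) ≠ none ∨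
      f (xV' i j false) ≠ none ∨ f (xV' i j true) ≠ none) →
      ∃ c : Bool, f (xV i j false) = some c ∧ f (xV' i j false) = some c ∧
        f (xV i j true) = some (!c) ∧ f (xV' i j true) = some (!c)))

/-- The set `Fₙ` of normal and funny assignments. -/
def Fset (n : ℕ) : Set PA := {f | NormalAssign n f ∨ ∃ m, FunnyAssign n f m}

-- The score function `sₙ`.
open Classical in
noncomputable def score (n : ℕ) (f : PA) : ℕ :=
  if h : ∃ m, FunnyAssign n f m then h.choose else maxLevel n f

/-! The mod-3 formulas `Ψₙ` of Section 7 (variables `xᵢ = 2i`, `yᵢ = 2i+1`). -/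

/-- The prefix `∃x₁∀y₁⋯∃xₙ∀yₙ`. -/
def modPrefix (n : ℕ) : List (Quant × ℕ) :=
  (List.range n).flatMap fun i =>
    [(Quant.ex, 2 * (i + 1)), (Quant.all, 2 * (i + 1) + 1)]

/-- Numeric value of a Boolean. -/
def boolVal (b : Bool) : ℕ := cond b 1 0

/-- The matrix `φ_{n,j}`: true iff `j + Σᵢ (xᵢ + yᵢ) ≢ n (mod 3)`. -/
def modMatrix (n j : ℕ) (g : ℕ → Bool) : Prop :=
  ¬ ((j + ∑ i ∈ Finset.Icc 1 n, (boolVal (g (2 * i)) + boolVal (g (2 * i + 1)))) % 3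
      = n % 3)

/-- The mod-3 formula `Ψₙ`. -/
def modQBC (n : ℕ) : QBC := ⟨modPrefix n, modMatrix n 0⟩

theorem mem_existVars_iff (P : List (Quant × ℕ)) (x : ℕ) :
    x ∈ existVars P ↔ (Quant.ex, x) ∈ P := by
  simp [existVars]

theorem mem_univVars_iff (P : List (Quant × ℕ)) (x : ℕ) :
    x ∈ univVars P ↔ (Quant.all, x) ∈ P := by
  simp [univVars]

theorem nodup_not_both {P : List (Quant × ℕ)} (h : (P.map Prod.snd).Nodup) {y : ℕ}
    (h1 : (Quant.all, y) ∈ P) (h2 : (Quant.ex, y) ∈ P) : False := by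
  have := List.inj_on_of_nodup_map h h1 h2 rfl
  simp at this

/-- Skolemization: a true quantified formula has a family of response functions. -/
theorem exists_strategy (M : (ℕ → Bool) → Prop) (P : List (Quant × ℕ)) :
    ∀ g : ℕ → Bool, (P.map Prod.snd).Nodup → evalQ P M g →
    ∃ σ : ℕ → (ℕ → Bool) → Bool,
      (∀ A B x, P = A ++ (Quant.ex, x) :: B → ∀ τ τ' : ℕ → Bool,
        (∀ y, (Quant.all, y) ∈ A → τ y = τ' y) → σ x τ = σ x τ') ∧
      ∀ τ : ℕ → Bool, ∃ h : ℕ → Bool, M h ∧ (∀ x, (Quant.ex, x) ∈ P → h x = σ x τ) ∧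
        (∀ y, (Quant.all, y) ∈ P → h y = τ y) ∧
        (∀ v, v ∉ P.map Prod.snd → h v = g v) := by
  induction P with
  | nil =>
    intro g _ he
    refine ⟨fun _ _ => false, ?_, ?_⟩
    · intro A B x h
      simp at h
    · intro τ
      exact ⟨g, he, by simp, by simp, by simp⟩
  | cons p P ih =>
    obtain ⟨q, v⟩ := p
    intro g hn he
    rw [List.map_cons, List.nodup_cons] at hn
    obtain ⟨hv, hn⟩ := hn
    simp only at hv
    have hne : ∀ q' x, (q', x) ∈ P → x ≠ v := by
      rintro q' x hx rfl
      exact hv (List.mem_map.2 ⟨_, hx, rfl⟩)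
    cases q with
    | ex =>
      obtain ⟨b, hb⟩ := he
      obtain ⟨σ, hσ, hp⟩ := ih _ hn hb
      refine ⟨fun x τ => if x = v then b else σ x τ, ?_, ?_⟩
      · intro A B x hs τ τ' ht
        rcases A with _ | ⟨a, A⟩
        · simp at hs
          simp [hs.1]
        · simp only [List.cons_append, List.cons.injEq] at hs
          have hx : x ≠ v := hne Quant.ex x (by rw [hs.2]; simp)
          simp only [hx, if_false]
          exact hσ A B x hs.2 τ τ' (fun y hy => ht y (List.mem_cons_of_mem _ hy))
      · intro τ
        obtain ⟨h, hM, h1, h2, h3⟩ := hp τ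
        have hhv : h v = b := by rw [h3 v hv]; simp
        refine ⟨h, hM, ?_, ?_, ?_⟩
        · intro x hx
          by_cases hxv : x = v
          · subst hxv; simp [hhv]
          · simp [hxv] at hx ⊢
            exact h1 x hx
        · intro y hy
          simp at hy
          exact h2 y hy
        · intro u hu
          simp only [List.map_cons, List.mem_cons, not_or] at hu
          rw [h3 u hu.2, Function.update_of_ne hu.1]
    | all =>
      have := fun b => ih _ hn (he b)
      choose σ hσ hp using this
      refine ⟨fun x τ => σ (τ v) x τ, ?_, ?_⟩
      · intro A B x hs τ τ' ht
        rcases A with _ | ⟨a, A⟩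
        · simp at hs
        · simp only [List.cons_append, List.cons.injEq] at hs
          have e : τ v = τ' v := ht v (by rw [← hs.1]; simp)
          simp only [e]
          exact hσ _ A B x hs.2 τ τ' (fun y hy => ht y (List.mem_cons_of_mem _ hy))
      · intro τ
        obtain ⟨h, hM, h1, h2, h3⟩ := hp (τ v) τ
        have hhv : h v = τ v := by rw [h3 v hv]; simp
        refine ⟨h, hM, ?_, ?_, ?_⟩
        · intro x hx
          simp at hx
          exact h1 x hx
        · intro y hy
          by_cases hxv : y = v
          · subst hxv; simp [hhv]
          · simp [hxv] at hy
            exact h2 y hy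
        · intro u hu
          simp only [List.map_cons, List.mem_cons, not_or] at hu
          rw [h3 u hu.2, Function.update_of_ne hu.1]

theorem idx_unique {P : List (Quant × ℕ)} (hn : (P.map Prod.snd).Nodup) {i j u : ℕ}
    (hi : (P[i]?).map Prod.snd = some u) (hj : (P[j]?).map Prod.snd = some u) : i = j := by
  rw [← List.getElem?_map] at hi hj
  have hlt : i < (P.map Prod.snd).length := (List.getElem?_eq_some_iff.1 hi).1
  exact (List.getElem?_inj hlt hn).1 (hi.trans hj.symm)

theorem strictPrec_of_split {P A B : List (Quant × ℕ)} {x y : ℕ}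
    (hn : (P.map Prod.snd).Nodup)
    (hs : P = A ++ (Quant.ex, x) :: B) (hy : (Quant.all, y) ∈ A) : strictPrec P y x := by
  obtain ⟨i, hi, hiy⟩ := List.getElem_of_mem hy
  have e1 : P[i]? = some (Quant.all, y) := by
    rw [hs, List.getElem?_append_left hi, List.getElem?_eq_getElem hi, hiy]
  have e2 : P[A.length]? = some (Quant.ex, x) := by
    rw [hs]; simp
  refine ⟨⟨i, A.length, by simp [e1], by simp [e2], Or.inl hi.le⟩, ?_⟩
  rintro ⟨j, k, hj, hk, h⟩
  have hj' : j = A.length := idx_unique hn hj (by simp [e2])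
  have hk' : k = i := idx_unique hn hk (by simp [e1])
  subst hj' hk'
  rcases h with h | ⟨_, h⟩
  · omega
  · have := h A.length hi.le le_rfl
    simp [e1, e2] at this

theorem exists_model (Φ : QBC) (hΦ : Φ.WellFormed) (ht : Φ.IsTrue) : ∃ σ, Φ.Model σ := by
  obtain ⟨hn, hm⟩ := hΦ
  obtain ⟨σ, hσ, hp⟩ := exists_strategy Φ.matrix Φ.pfx (fun _ => false) hn (ht _)
  refine ⟨σ, ?_, ?_⟩
  · intro x hx τ τ' h
    rw [mem_existVars_iff] at hx
    obtain ⟨A, B, hs⟩ := List.append_of_mem hx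
    refine hσ A B x hs τ τ' fun y hy => h y ?_ (strictPrec_of_split hn hs hy)
    rw [mem_univVars_iff, hs]
    exact List.mem_append_left _ hy
  · intro τ
    obtain ⟨h, hM, h1, h2, -⟩ := hp τ
    refine (hm _ _ ?_).1 hM
    intro v hv
    obtain ⟨⟨q, w⟩, hw, rfl⟩ := List.mem_map.1 hv
    simp only [playE, mem_existVars_iff]
    cases q with
    | ex => rw [if_pos hw]; exact h1 _ hw
    | all => rw [if_neg (fun h' => nodup_not_both hn hw h')]; exact h2 _ hw

theorem forallElim_sound (Φ : QBC) (hn : Φ.vars.Nodup) {C D : PA}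
    (h : ForallElim Φ.pfx C D) (σ : ℕ → (ℕ → Bool) → Bool)
    (hD : ModelOfClause Φ σ D) : ModelOfClause Φ σ C := by
  obtain ⟨y, b, hy, hCy, rfl, hprec⟩ := h
  refine ⟨hD.1, fun τ hC => hD.2 (Function.update τ y b) ?_⟩
  intro u c hu
  by_cases huy : u = y
  · subst huy
    simp at hu
    have : u ∉ existVars Φ.pfx := by
      rw [mem_existVars_iff]
      rw [mem_univVars_iff] at hy
      exact fun h' => nodup_not_both hn hy h'
    simp [playE, this, hu]
  · rw [Function.update_of_ne huy] at hu
    have hc := hC u c hu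
    rw [← hc]
    unfold playE
    split_ifs with hex
    · refine hD.1 u hex _ _ fun z _ hzu => ?_
      refine Function.update_of_ne ?_ _ _
      rintro rfl
      exact hzu.2 (hprec u (by simp [hu]))
    · exact Function.update_of_ne huy _ _

theorem resolvent_sound {γ α β : PA} {v : ℕ} (h : IsResolvent γ α β v) (g : ℕ → Bool)
    (hg : TotalExtends g γ) : TotalExtends g α ∨ TotalExtends g β := by
  obtain ⟨b, ha, hb, -, hu, hc⟩ := h
  by_cases hgv : g v = b
  · left
    intro u c huc
    by_cases huv : u = v
    · subst huv
      rw [ha] at huc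
      simpa [hgv] using huc
    · exact hg u c (by rw [hu u huv, huc]; rfl)
  · right
    intro u c huc
    by_cases huv : u = v
    · subst huv
      rw [hb] at huc
      have : (!b) = c := by simpa using huc
      rw [← this]
      revert hgv
      cases g u <;> cases b <;> simp
    · refine hg u c ?_
      rw [hu u huv]
      cases hα : α u with
      | none => simpa using huc
      | some d => simp [hc u huv d c hα huc]

theorem step_sound (Φ : QBC) (hΦ : Φ.WellFormed) (H : Set PA)
    (hH : IsAxiomSet Φ H) (L : List QUStep) (hL : IsQUProof Φ H L)
    (σ : ℕ → (ℕ → Bool) → Bool) (hσ : Φ.Model σ) (i : ℕ) :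
    ∀ C : PA, stepClause? L i = some C → ModelOfClause Φ σ C := by
  induction i using Nat.strong_induction_on with
  | _ i ih =>
    intro C hC
    have hv := hL i
    unfold validStep at hv
    unfold stepClause? at hC
    cases hs : L[i]? with
    | none => simp [hs] at hC
    | some s =>
      rw [hs] at hv hC
      cases s with
      | ax D =>
        simp only [Option.map_some, QUStep.clause, Option.some.injEq] at hC
        subst hC
        exact (hH _ hv).2 σ hσ
      | elim D j =>
        simp only [Option.map_some, QUStep.clause, Option.some.injEq] at hC
        subst hC
        obtain ⟨hj, E, hE, hF⟩ := hv
        exact forallElim_sound Φ hΦ.1 hF σ (ih j hj E hE)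
      | res D j k v =>
        simp only [Option.map_some, QUStep.clause, Option.some.injEq] at hC
        subst hC
        obtain ⟨hj, hk, α, β, hα, hβ, hR⟩ := hv
        refine ⟨hσ.1, fun τ hτ => ?_⟩
        rcases resolvent_sound hR _ hτ with h | h
        · exact (ih j hj α hα).2 τ h
        · exact (ih k hk β hβ).2 τ h

theorem soundness_QU_resolution (Φ : QBC) (hΦ : Φ.WellFormed) (H : Set PA)
    (hH : IsAxiomSet Φ H) (L : List QUStep) (hL : IsQUProof Φ H L) :
    (∀ C : PA, AppearsIn L C → ∀ σ, Φ.Model σ → ModelOfClause Φ σ C) ∧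
    (AppearsIn L emptyPA → Φ.IsFalse) := by
  refine ⟨?_, ?_⟩
  · rintro C ⟨i, hi⟩ σ hσ
    exact step_sound Φ hΦ H hH L hL σ hσ i C hi
  · rintro ⟨i, hi⟩ ht
    obtain ⟨σ, hσ⟩ := exists_model Φ hΦ ht
    refine (step_sound Φ hΦ H hH L hL σ hσ i _ hi).2 (fun _ => false) ?_
    intro v b hv
    simp [emptyPA] at hv
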